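/- For every ε > 0 there exists a constant c = c(ε) > 0 such that the following holds: for every finite graph G, the random graph G^c — whose vertex set is V(G) and whose edge set is a uniformly random subset of E(G) of size min(⌈c⌉, e(G)) — satisfies q*(G^c) > q*(G) − ε with probability greater than 1 − ε. -/

import Mathlib

open Finset
open scoped Classical

/-- The number of edges of a finite graph. -/
noncomputable def edgeCount {V : Type} [Fintype V] [DecidableEq V] (G : SimpleGraph V) : ℕ :=
  G.edgeFinset.card

/-- vol(A): the sum over vertices of A of their degree in G. -/
noncomputable def degSum {V : Type} [Fintype V] [DecidableEq V] (G : SimpleGraph V)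
    (A : Finset V) : ℕ :=
  ∑ v ∈ A, G.degree v

/-- e(A): the number of edges of G with both endpoints in A. -/
noncomputable def intEdges {V : Type} [Fintype V] [DecidableEq V] (G : SimpleGraph V)
    (A : Finset V) : ℕ :=
  (G.edgeFinset.filter (fun e => ∀ v ∈ e, v ∈ A)).card

/-- The modularity score q_𝒜(G) of a vertex partition 𝒜 of G; it is 0 if G has no edges. -/
noncomputable def modScore {V : Type} [Fintype V] [DecidableEq V] (G : SimpleGraph V)
    (P : Finpartition (univ : Finset V)) : ℝ :=
  if edgeCount G = 0 then 0 else
    (∑ A ∈ P.parts, (intEdges G A : ℝ)) / (edgeCount G : ℝ)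
      - (∑ A ∈ P.parts, (degSum G A : ℝ) ^ 2) / (4 * (edgeCount G : ℝ) ^ 2)

/-- The modularity q*(G) of a graph: the maximum of q_𝒜(G) over all vertex partitions 𝒜. -/
noncomputable def modularity {V : Type} [Fintype V] [DecidableEq V] (G : SimpleGraph V) : ℝ :=
  ⨆ P : Finpartition (univ : Finset V), modScore G P

/-- The probability that the random subgraph G_p of G (each edge of G retained
independently with probability p) satisfies the predicate Q. -/
noncomputable def subgraphProb {V : Type} [Fintype V] [DecidableEq V] (G : SimpleGraph V)
    (p : ℝ) (Q : SimpleGraph V → Prop) : ℝ :=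
  ∑ F ∈ G.edgeFinset.powerset,
    if Q (SimpleGraph.fromEdgeSet (F : Set (Sym2 V))) then
      p ^ F.card * (1 - p) ^ (G.edgeFinset.card - F.card)
    else 0

/-- Probability, under a uniformly random subset of the edge set of G of size
min(k, e(G)), that the resulting graph satisfies Q. -/
noncomputable def uniformSubProb {V : Type} [Fintype V] [DecidableEq V] (G : SimpleGraph V)
    (k : ℕ) (Q : SimpleGraph V → Prop) : ℝ :=
  (∑ F ∈ G.edgeFinset.powersetCard (min k G.edgeFinset.card),
      if Q (SimpleGraph.fromEdgeSet (F : Set (Sym2 V))) then 1 else 0) /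
    ((G.edgeFinset.powersetCard (min k G.edgeFinset.card)).card : ℝ)

/-- The number of `k`-subsets of `s` containing two distinct elements of `s` does not depend on
the two elements. -/
lemma exists_card_filter_pair_mem {α : Type*} [DecidableEq α] (s : Finset α) (k : ℕ) :
    ∃ c : ℕ, ∀ a ∈ s, ∀ b ∈ s, a ≠ b →
      #{F ∈ s.powersetCard k | a ∈ F ∧ b ∈ F} = c := by
  rcases lt_or_ge k 2 with hk | hk
  · refine ⟨0, fun a _ b _ hab => ?_⟩
    rw [card_eq_zero, filter_eq_empty_iff]
    rintro F hF ⟨haF, hbF⟩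
    have h : #({a, b} : Finset α) ≤ #F := card_le_card (by grind)
    rw [card_pair hab, (mem_powersetCard.1 hF).2] at h
    omega
  · refine ⟨(#s - 2).choose (k - 2), fun a ha b hb hab => ?_⟩
    have h := card_filter_powersetCard_subset ({a, b} : Finset α) s k (by grind)
      (by rwa [card_pair hab])
    rw [card_pair hab] at h
    rw [← h]
    congr 1
    ext F
    simp [insert_subset_iff]

lemma card_filter_mem_powersetCard {α : Type*} [DecidableEq α] {s : Finset α} {k : ℕ}
    (hk : 1 ≤ k) {a : α} (ha : a ∈ s) :
    #{F ∈ s.powersetCard k | a ∈ F} = (#s - 1).choose (k - 1) := by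
  have h := card_filter_powersetCard_subset ({a} : Finset α) s k (by simpa using ha) (by simpa)
  simpa using h

lemma sum_powersetCard_sq_sum_le {α : Type*} [DecidableEq α] (s : Finset α) {k : ℕ}
    (hk : 1 ≤ k) (g : α → ℝ) (hg : ∑ a ∈ s, g a = 0) :
    ∑ F ∈ s.powersetCard k, (∑ a ∈ F, g a) ^ 2 ≤
      ((#s - 1).choose (k - 1) : ℝ) * ∑ a ∈ s, g a ^ 2 := by
  obtain ⟨c, hc⟩ := exists_card_filter_pair_mem s k
  have hexp : ∀ F ∈ s.powersetCard k, (∑ a ∈ F, g a) ^ 2 =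
      ∑ a ∈ s, ∑ b ∈ s, if a ∈ F ∧ b ∈ F then g a * g b else 0 := by
    intro F hF
    have hFs := (mem_powersetCard.1 hF).1
    have h1 : ∑ a ∈ F, g a = ∑ a ∈ s, if a ∈ F then g a else 0 := by
      rw [← sum_filter, filter_mem_eq_inter, inter_eq_right.2 hFs]
    rw [h1, sq, sum_mul_sum]
    refine sum_congr rfl fun a _ => sum_congr rfl fun b _ => ?_
    split_ifs <;> simp_all
  have hcount : ∀ a ∈ s, ∀ b ∈ s,
      (∑ F ∈ s.powersetCard k, if a ∈ F ∧ b ∈ F then g a * g b else 0) =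
        c * (g a * g b) +
          if a = b then (((#s - 1).choose (k - 1) : ℝ) - c) * (g a * g b) else 0 := by
    intro a ha b hb
    rw [← sum_filter, sum_const, nsmul_eq_mul]
    by_cases hab : a = b
    · subst hab
      simp only [and_self, if_true, card_filter_mem_powersetCard hk ha]
      ring
    · simp [hab, hc a ha b hb hab]
  calc ∑ F ∈ s.powersetCard k, (∑ a ∈ F, g a) ^ 2
      = ∑ a ∈ s, ∑ b ∈ s, ∑ F ∈ s.powersetCard k,
          if a ∈ F ∧ b ∈ F then g a * g b else 0 := by
        rw [sum_congr rfl hexp, sum_comm]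
        exact sum_congr rfl fun a _ => sum_comm
    _ = ∑ a ∈ s, ∑ b ∈ s, (c * (g a * g b) +
          if a = b then (((#s - 1).choose (k - 1) : ℝ) - c) * (g a * g b) else 0) :=
        sum_congr rfl fun a ha => sum_congr rfl fun b hb => hcount a ha b hb
    _ = c * (∑ a ∈ s, g a) ^ 2 + (((#s - 1).choose (k - 1) : ℝ) - c) * ∑ a ∈ s, g a ^ 2 := by
        simp only [sum_add_distrib, sum_ite_eq]
        congr 1
        · rw [sq, sum_mul_sum, mul_sum]
          exact sum_congr rfl fun a _ => by rw [mul_sum]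
        · rw [mul_sum]
          exact sum_congr rfl fun a ha => by rw [if_pos ha, sq]
    _ ≤ _ := by
        have : 0 ≤ (c : ℝ) * ∑ a ∈ s, g a ^ 2 := by positivity
        rw [hg]
        linarith

/-- Variance bound for sampling without replacement. -/
lemma sum_powersetCard_sq_avg_sub_avg_le {α : Type*} [DecidableEq α] (s : Finset α) {k : ℕ}
    (hk : 1 ≤ k) (hks : k ≤ #s) (f : α → ℝ) :
    ∑ F ∈ s.powersetCard k, ((∑ a ∈ F, f a) / k - (∑ a ∈ s, f a) / #s) ^ 2 ≤
      ((#s).choose k : ℝ) / (k * #s) * ∑ a ∈ s, f a ^ 2 := by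
  have hk0 : (0 : ℝ) < k := by exact_mod_cast hk
  have hs0 : (0 : ℝ) < #s := by exact_mod_cast hk.trans hks
  obtain ⟨μ, hμ⟩ : ∃ μ : ℝ, (∑ a ∈ s, f a) / #s = μ := ⟨_, rfl⟩
  have hμs : ∑ a ∈ s, f a = #s * μ := by rw [← hμ]; field_simp
  rw [hμ]
  clear hμ
  have hg : ∑ a ∈ s, (f a - μ) / k = 0 := by
    rw [← sum_div, sum_sub_distrib, sum_const, nsmul_eq_mul, hμs]
    simp
  have hL : ∀ F ∈ s.powersetCard k,
      ((∑ a ∈ F, f a) / k - μ) ^ 2 = (∑ a ∈ F, (f a - μ) / k) ^ 2 := by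
    intro F hF
    rw [← sum_div, sum_sub_distrib, sum_const, nsmul_eq_mul, (mem_powersetCard.1 hF).2]
    congr 1
    field_simp
  have hsq : ∑ a ∈ s, ((f a - μ) / k) ^ 2 ≤ (∑ a ∈ s, f a ^ 2) / (k : ℝ) ^ 2 := by
    have h : ∑ a ∈ s, (f a - μ) ^ 2 = ∑ a ∈ s, f a ^ 2 - #s * μ ^ 2 := by
      simp only [sub_sq, sum_add_distrib, sum_sub_distrib, sum_const, nsmul_eq_mul, ← sum_mul,
        ← mul_sum, hμs]
      ring
    simp only [div_pow, ← sum_div]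
    rw [h]
    gcongr
    have : 0 ≤ (#s : ℝ) * μ ^ 2 := by positivity
    linarith
  have hch : ((#s - 1).choose (k - 1) : ℝ) * #s = (#s).choose k * k := by
    obtain ⟨n, hn⟩ : ∃ n, #s = n + 1 := ⟨#s - 1, by omega⟩
    obtain ⟨j, hj⟩ : ∃ j, k = j + 1 := ⟨k - 1, by omega⟩
    rw [hn, hj]
    have := Nat.add_one_mul_choose_eq n j
    simp only [Nat.add_sub_cancel]
    rw [mul_comm]
    exact_mod_cast this
  have hch' : ((#s - 1).choose (k - 1) : ℝ) = (#s).choose k * k / #s := by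
    field_simp
    linarith
  rw [sum_congr rfl hL]
  refine (sum_powersetCard_sq_sum_le s hk _ hg).trans ?_
  rw [hch']
  refine (mul_le_mul_of_nonneg_left hsq (by positivity)).trans (le_of_eq ?_)
  field_simp

/-- Half the number of endpoints of `e` lying in `A`. -/
noncomputable def endpointShare {V : Type} [DecidableEq V] (A : Finset V) (e : Sym2 V) : ℝ :=
  (#{v ∈ A | v ∈ e} : ℝ) / 2

/-- The number of parts of `P` containing both endpoints of `e`. -/
noncomputable def internalCount {V : Type} [Fintype V] [DecidableEq V]
    (P : Finpartition (univ : Finset V)) (e : Sym2 V) : ℝ :=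
  ∑ A ∈ P.parts, if ∀ v ∈ e, v ∈ A then 1 else 0

lemma endpointShare_nonneg {V : Type} [DecidableEq V] (A : Finset V) (e : Sym2 V) :
    0 ≤ endpointShare A e := by
  unfold endpointShare
  positivity

lemma card_filter_mem_sym2 {V : Type} [Fintype V] [DecidableEq V] {e : Sym2 V} (he : ¬ e.IsDiag) :
    #{v ∈ (univ : Finset V) | v ∈ e} = 2 := by
  rw [← Sym2.card_toFinset_of_not_isDiag e he]
  congr 1
  ext v
  simp

lemma sum_endpointShare {V : Type} [Fintype V] [DecidableEq V]
    (P : Finpartition (univ : Finset V)) {e : Sym2 V} (he : ¬ e.IsDiag) :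
    ∑ A ∈ P.parts, endpointShare A e = 1 := by
  have h : ∑ A ∈ P.parts, #{v ∈ A | v ∈ e} = 2 := by
    rw [← card_filter_mem_sym2 he]
    conv_rhs => rw [← P.biUnion_parts]
    rw [filter_biUnion, card_biUnion]
    · simp only [id]
    · intro A hA B hB hAB
      exact disjoint_filter_filter (P.disjoint hA hB hAB)
  unfold endpointShare
  rw [← sum_div, ← Nat.cast_sum, h]
  norm_num

lemma sum_sq_endpointShare_le {V : Type} [Fintype V] [DecidableEq V]
    (P : Finpartition (univ : Finset V)) {e : Sym2 V} (he : ¬ e.IsDiag) :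
    ∑ A ∈ P.parts, endpointShare A e ^ 2 ≤ 1 := by
  have h := sum_endpointShare P he
  rw [← h]
  refine sum_le_sum fun A hA => ?_
  have h1 : endpointShare A e ≤ 1 := by
    rw [← h]
    exact single_le_sum (fun B _ => endpointShare_nonneg B e) hA
  nlinarith [endpointShare_nonneg A e]

lemma sq_internalCount_le {V : Type} [Fintype V] [DecidableEq V]
    (P : Finpartition (univ : Finset V)) {e : Sym2 V} (he : ¬ e.IsDiag) :
    internalCount P e ^ 2 ≤ 1 := by
  have h0 : 0 ≤ internalCount P e := sum_nonneg fun A _ => by split_ifs <;> norm_num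
  have h1 : internalCount P e ≤ 1 := by
    rw [← sum_endpointShare P he]
    refine sum_le_sum fun A _ => ?_
    split_ifs with h
    · have h2 : #{v ∈ A | v ∈ e} = 2 := by
        rw [← card_filter_mem_sym2 he]
        congr 1
        ext v
        simpa using h v
      rw [endpointShare, h2]
      norm_num
    · exact endpointShare_nonneg A e
  nlinarith

lemma degSum_eq_sum_endpointShare {V : Type} [Fintype V] [DecidableEq V] (G : SimpleGraph V)
    (A : Finset V) : (degSum G A : ℝ) = 2 * ∑ e ∈ G.edgeFinset, endpointShare A e := by
  have h : degSum G A = ∑ e ∈ G.edgeFinset, #{v ∈ A | v ∈ e} := by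
    simp only [card_filter]
    rw [sum_comm]
    refine sum_congr rfl fun v _ => ?_
    rw [← card_filter, ← SimpleGraph.card_incidenceFinset_eq_degree,
      SimpleGraph.incidenceFinset_eq_filter]
  rw [h, mul_sum, Nat.cast_sum]
  refine sum_congr rfl fun e _ => ?_
  rw [endpointShare]
  ring

lemma sum_intEdges_eq_sum_internalCount {V : Type} [Fintype V] [DecidableEq V]
    (G : SimpleGraph V) (P : Finpartition (univ : Finset V)) :
    ∑ A ∈ P.parts, (intEdges G A : ℝ) = ∑ e ∈ G.edgeFinset, internalCount P e := by
  unfold internalCount intEdges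
  rw [sum_comm]
  simp

lemma modScore_eq {V : Type} [Fintype V] [DecidableEq V] (G : SimpleGraph V)
    (P : Finpartition (univ : Finset V)) (hG : edgeCount G ≠ 0) :
    modScore G P = (∑ e ∈ G.edgeFinset, internalCount P e) / edgeCount G -
      ∑ A ∈ P.parts, ((∑ e ∈ G.edgeFinset, endpointShare A e) / edgeCount G) ^ 2 := by
  have hG' : (edgeCount G : ℝ) ≠ 0 := by exact_mod_cast hG
  rw [modScore, if_neg hG, sum_intEdges_eq_sum_internalCount]
  congr 1
  rw [sum_div]
  refine sum_congr rfl fun A _ => ?_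
  rw [degSum_eq_sum_endpointShare]
  field_simp
  ring

lemma edgeFinset_fromEdgeSet_of_subset {V : Type} [Fintype V] [DecidableEq V]
    {G : SimpleGraph V} {F : Finset (Sym2 V)} (hF : F ⊆ G.edgeFinset)
    {_ : Fintype (SimpleGraph.fromEdgeSet (F : Set (Sym2 V))).edgeSet} :
    (SimpleGraph.fromEdgeSet (F : Set (Sym2 V))).edgeFinset = F := by
  ext e
  have h : e ∈ F → ¬ e.IsDiag := fun he => G.not_isDiag_of_mem_edgeFinset (hF he)
  simpa using h

lemma modScore_le_modularity {V : Type} [Fintype V] [DecidableEq V] (G : SimpleGraph V)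
    (P : Finpartition (univ : Finset V)) : modScore G P ≤ modularity G :=
  le_ciSup (Set.finite_range fun P => modScore G P).bddAbove P

lemma exists_modScore_eq_modularity {V : Type} [Fintype V] [DecidableEq V] (G : SimpleGraph V) :
    ∃ P : Finpartition (univ : Finset V), modScore G P = modularity G :=
  exists_eq_ciSup_of_finite

/-- The squared distance between the statistics of `P` on the edge samples `F` and `E`. -/
noncomputable def sampleError {V : Type} [Fintype V] [DecidableEq V]
    (P : Finpartition (univ : Finset V)) (E F : Finset (Sym2 V)) : ℝ :=
  ((∑ e ∈ F, internalCount P e) / #F - (∑ e ∈ E, internalCount P e) / #E) ^ 2 +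
    ∑ A ∈ P.parts,
      ((∑ e ∈ F, endpointShare A e) / #F - (∑ e ∈ E, endpointShare A e) / #E) ^ 2

lemma sampleError_nonneg {V : Type} [Fintype V] [DecidableEq V]
    (P : Finpartition (univ : Finset V)) (E F : Finset (Sym2 V)) : 0 ≤ sampleError P E F := by
  unfold sampleError
  positivity

lemma sum_sampleError_le {V : Type} [Fintype V] [DecidableEq V]
    (P : Finpartition (univ : Finset V)) (E : Finset (Sym2 V)) (hE : ∀ e ∈ E, ¬ e.IsDiag)
    {k : ℕ} (hk : 1 ≤ k) (hkE : k ≤ #E) :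
    ∑ F ∈ E.powersetCard k, sampleError P E F ≤ 2 * (#E).choose k / k := by
  have hE0 : (0 : ℝ) < #E := by exact_mod_cast hk.trans hkE
  have hk0 : (0 : ℝ) < k := by exact_mod_cast hk
  set c : ℝ := ((#E).choose k : ℝ) / (k * #E) with hc
  have hc0 : 0 ≤ c := by positivity
  have h1 := sum_powersetCard_sq_avg_sub_avg_le E hk hkE (internalCount P)
  have h1' : ∑ e ∈ E, internalCount P e ^ 2 ≤ #E := by
    simpa using sum_le_card_nsmul E _ 1 fun e he => sq_internalCount_le P (hE e he)
  have h2 := sum_le_sum fun A (_ : A ∈ P.parts) =>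
    sum_powersetCard_sq_avg_sub_avg_le E hk hkE (endpointShare A)
  have h2' : ∑ A ∈ P.parts, ∑ e ∈ E, endpointShare A e ^ 2 ≤ #E := by
    rw [sum_comm]
    simpa using sum_le_card_nsmul E _ 1 fun e he => sum_sq_endpointShare_le P (hE e he)
  rw [← mul_sum, sum_comm] at h2
  have hsum : ∑ F ∈ E.powersetCard k, sampleError P E F =
      ∑ F ∈ E.powersetCard k,
        ((∑ e ∈ F, internalCount P e) / k - (∑ e ∈ E, internalCount P e) / #E) ^ 2 +
      ∑ F ∈ E.powersetCard k, ∑ A ∈ P.parts,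
        ((∑ e ∈ F, endpointShare A e) / k - (∑ e ∈ E, endpointShare A e) / #E) ^ 2 := by
    rw [← sum_add_distrib]
    refine sum_congr rfl fun F hF => ?_
    rw [sampleError, (mem_powersetCard.1 hF).2]
  have hfin : 2 * ((#E).choose k : ℝ) / k = c * #E + c * #E := by
    rw [hc]
    field_simp
    ring
  rw [hsum, hfin]
  exact add_le_add (h1.trans (mul_le_mul_of_nonneg_left h1' hc0))
    (h2.trans (mul_le_mul_of_nonneg_left h2' hc0))

lemma sum_sq_avg_endpointShare_le {V : Type} [Fintype V] [DecidableEq V]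
    (P : Finpartition (univ : Finset V)) (E : Finset (Sym2 V)) (hE : ∀ e ∈ E, ¬ e.IsDiag)
    (hE0 : 0 < #E) :
    ∑ A ∈ P.parts, ((∑ e ∈ E, endpointShare A e) / #E) ^ 2 ≤ 1 := by
  have hE0' : (0 : ℝ) < #E := by exact_mod_cast hE0
  have hnn : ∀ A, 0 ≤ (∑ e ∈ E, endpointShare A e) / (#E : ℝ) := fun A =>
    div_nonneg (sum_nonneg fun e _ => endpointShare_nonneg A e) hE0'.le
  have h : ∑ A ∈ P.parts, (∑ e ∈ E, endpointShare A e) / (#E : ℝ) = 1 := by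
    rw [← sum_div, sum_comm, sum_congr rfl fun e he => sum_endpointShare P (hE e he)]
    simp [hE0'.ne']
  rw [← h]
  refine sum_le_sum fun A hA => ?_
  have h1 : (∑ e ∈ E, endpointShare A e) / (#E : ℝ) ≤ 1 := by
    rw [← h]
    exact single_le_sum (fun B _ => hnn B) hA
  nlinarith [hnn A]

/-- Changing the statistics of `P` by a small amount changes its score by a small amount. -/
lemma modScore_sub_le_modScore_fromEdgeSet {V : Type} [Fintype V] [DecidableEq V]
    (G : SimpleGraph V) (P : Finpartition (univ : Finset V)) {F : Finset (Sym2 V)}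
    (hF : F ⊆ G.edgeFinset) (hF0 : 0 < #F) {δ : ℝ} (hδ : 0 < δ) (hδ1 : δ ≤ 1)
    (h : sampleError P G.edgeFinset F ≤ δ ^ 2) :
    modScore G P - 4 * δ ≤ modScore (SimpleGraph.fromEdgeSet (F : Set (Sym2 V))) P := by
  have hG0 : 0 < #G.edgeFinset := hF0.trans_le (card_le_card hF)
  have hnd : ∀ e ∈ G.edgeFinset, ¬ e.IsDiag := fun e he => G.not_isDiag_of_mem_edgeFinset he
  have hcF : edgeCount (SimpleGraph.fromEdgeSet (F : Set (Sym2 V))) = #F := by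
    rw [edgeCount, edgeFinset_fromEdgeSet_of_subset hF]
  rw [modScore_eq G P hG0.ne', modScore_eq _ P (by rw [hcF]; exact hF0.ne'), hcF,
    edgeFinset_fromEdgeSet_of_subset hF]
  have hy := sum_sq_avg_endpointShare_le P G.edgeFinset hnd hG0
  unfold sampleError at h
  unfold edgeCount
  set z₁ := (∑ e ∈ F, internalCount P e) / (#F : ℝ)
  set z₀ := (∑ e ∈ G.edgeFinset, internalCount P e) / (#G.edgeFinset : ℝ)
  set x : Finset V → ℝ := fun A => (∑ e ∈ F, endpointShare A e) / (#F : ℝ)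
  set y : Finset V → ℝ :=
    fun A => (∑ e ∈ G.edgeFinset, endpointShare A e) / (#G.edgeFinset : ℝ)
  change (z₁ - z₀) ^ 2 + ∑ A ∈ P.parts, (x A - y A) ^ 2 ≤ δ ^ 2 at h
  change ∑ A ∈ P.parts, y A ^ 2 ≤ 1 at hy
  change z₀ - ∑ A ∈ P.parts, y A ^ 2 - 4 * δ ≤ z₁ - ∑ A ∈ P.parts, x A ^ 2
  have hD0 : 0 ≤ ∑ A ∈ P.parts, (x A - y A) ^ 2 := sum_nonneg fun A _ => sq_nonneg _
  have hz : z₀ - z₁ ≤ δ := by nlinarith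
  have hD : ∑ A ∈ P.parts, (x A - y A) ^ 2 ≤ δ ^ 2 := by nlinarith [sq_nonneg (z₁ - z₀)]
  have hxy : ∑ A ∈ P.parts, x A ^ 2 ≤
      ∑ A ∈ P.parts, ((1 + δ) * y A ^ 2 + (1 + 1 / δ) * (x A - y A) ^ 2) := by
    refine sum_le_sum fun A _ => ?_
    have h3 : 0 ≤ (1 / δ) * (δ * y A - (x A - y A)) ^ 2 := by positivity
    have h4 : (1 / δ) * (δ * y A - (x A - y A)) ^ 2 =
        δ * y A ^ 2 - 2 * y A * (x A - y A) + (1 / δ) * (x A - y A) ^ 2 := by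
      field_simp
      ring
    nlinarith
  rw [sum_add_distrib, ← mul_sum, ← mul_sum] at hxy
  have h5 : (1 + 1 / δ) * ∑ A ∈ P.parts, (x A - y A) ^ 2 ≤ (1 + 1 / δ) * δ ^ 2 :=
    mul_le_mul_of_nonneg_left hD (by positivity)
  have h6 : (1 + 1 / δ) * δ ^ 2 = δ ^ 2 + δ := by
    field_simp
  nlinarith

lemma one_sub_lt_sum_ite_div_card {ι : Type*} {S : Finset ι} (hS : S.Nonempty) {Q : ι → Prop}
    (T : ι → ℝ) (hT : ∀ i ∈ S, 0 ≤ T i) {t ε : ℝ} (ht : 0 < t)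
    (hQ : ∀ i ∈ S, T i ≤ t → Q i) (hsum : ∑ i ∈ S, T i < ε * t * #S) :
    1 - ε < (∑ i ∈ S, if Q i then (1 : ℝ) else 0) / #S := by
  have hS0 : (0 : ℝ) < #S := by exact_mod_cast hS.card_pos
  have h : ∑ i ∈ S, (1 - T i / t) ≤ ∑ i ∈ S, if Q i then (1 : ℝ) else 0 := by
    refine sum_le_sum fun i hi => ?_
    split_ifs with hq
    · have := div_nonneg (hT i hi) ht.le
      linarith
    · have : t < T i := lt_of_not_ge fun hle => hq (hQ i hi hle)
      have := (one_lt_div ht).2 this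
      linarith
  rw [sum_sub_distrib, sum_const, nsmul_eq_mul, mul_one, ← sum_div] at h
  have h2 : (∑ i ∈ S, T i) / t < ε * #S := by
    rw [div_lt_iff₀ ht]
    linarith
  rw [lt_div_iff₀ hS0]
  linarith

/-- Corollary (c-edge-limited search): for every ε > 0 there is c = c(ε) > 0 such that
for every finite graph G, the random graph G^c (whose edge set is a uniformly random
subset of E(G) of size min(⌈c⌉, e(G))) satisfies q*(G^c) > q*(G) − ε with probability
greater than 1 − ε. -/
theorem statement3 :
    ∀ ε : ℝ, 0 < ε →
      ∃ c : ℝ, 0 < c ∧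
        ∀ (V : Type) [Fintype V] [DecidableEq V] (G : SimpleGraph V),
          1 - ε < uniformSubProb G ⌈c⌉₊ (fun H => modularity G - ε < modularity H) := by
  intro ε hε
  obtain ⟨δ, hδ, hδ1, hδε⟩ : ∃ δ : ℝ, 0 < δ ∧ δ ≤ 1 ∧ 4 * δ < ε :=
    ⟨min 1 (ε / 8), by positivity, min_le_left _ _, by linarith [min_le_right 1 (ε / 8)]⟩
  refine ⟨2 / (ε * δ ^ 2) + 1, by positivity, ?_⟩
  intro V _ _ G
  set k := ⌈2 / (ε * δ ^ 2) + 1⌉₊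
  have hkc : 2 / (ε * δ ^ 2) + 1 ≤ (k : ℝ) := Nat.le_ceil _
  have hpos : 0 < 2 / (ε * δ ^ 2) := by positivity
  have hk0 : (0 : ℝ) < k := by linarith
  have hk1 : 1 ≤ k := by exact_mod_cast hk0
  unfold uniformSubProb
  rcases le_total (#G.edgeFinset) k with hle | hle
  · rw [min_eq_right hle, powersetCard_self, sum_singleton, SimpleGraph.coe_edgeFinset,
      SimpleGraph.fromEdgeSet_edgeSet, if_pos (by linarith), card_singleton]
    norm_num [hε]
  · rw [min_eq_left hle]
    obtain ⟨P, hP⟩ := exists_modScore_eq_modularity G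
    refine one_sub_lt_sum_ite_div_card (powersetCard_nonempty.2 hle)
      (sampleError P G.edgeFinset) (fun F _ => sampleError_nonneg P _ F) (pow_pos hδ 2) ?_ ?_
    · intro F hF hT
      obtain ⟨hFE, hFk⟩ := mem_powersetCard.1 hF
      have h1 := modScore_sub_le_modScore_fromEdgeSet G P hFE (by omega) hδ hδ1 hT
      have h2 := modScore_le_modularity (SimpleGraph.fromEdgeSet (F : Set (Sym2 V))) P
      linarith
    · have h1 := sum_sampleError_le P G.edgeFinset
        (fun e he => G.not_isDiag_of_mem_edgeFinset he) hk1 hle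
      refine h1.trans_lt ?_
      have hch : (0 : ℝ) < (#G.edgeFinset).choose k := by exact_mod_cast Nat.choose_pos hle
      have h2 : 2 < ε * δ ^ 2 * k := by
        have : 2 / (ε * δ ^ 2) < k := by linarith
        rw [div_lt_iff₀ (by positivity)] at this
        linarith
      rw [card_powersetCard, div_lt_iff₀ hk0]
      nlinarith
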